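/- arXiv:2207.13903 — 2 statements merged into one kernel-verified Lean document; each statement's English description precedes it below -/
import Mathlib

section
/- Let a_0, a_1, b_0, b_1, b_2 be positive real numbers, and set a(x) = a_0·(x+a_1) and b(x) = b_0·(x+b_1)(x+b_2) for x ≥ 0. If b_1 ≤ a_1 ≤ b_2, then the double net {1/(b(m) + a(m)·n)}_{m,n ∈ ℤ₊} is joint completely monotone. Conversely, if the double net {1/(b(m) + a(m)·n)}_{m,n ∈ ℤ₊} is joint completely monotone, then 1/a_1 ≤ 1/b_1 + 1/b_2. -/
noncomputable section

/-- Forward difference operator for sequences. -/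
def dSeq (s : ℕ → ℝ) : ℕ → ℝ := fun m => s (m + 1) - s m

/-- A sequence is completely monotone. -/
def CompMono (s : ℕ → ℝ) : Prop := ∀ k m : ℕ, 0 ≤ (-1 : ℝ) ^ k * dSeq^[k] s m

/-- A completely monotone sequence is minimal. -/
def MinCompMono (s : ℕ → ℝ) : Prop :=
  CompMono s ∧ ∀ ε : ℝ, 0 < ε → ¬ CompMono (fun k => s k - if k = 0 then ε else 0)

/-- First forward difference operator for double nets. -/
def d1 (a : ℕ → ℕ → ℝ) : ℕ → ℕ → ℝ := fun m n => a (m + 1) n - a m n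

/-- Second forward difference operator for double nets. -/
def d2 (a : ℕ → ℕ → ℝ) : ℕ → ℕ → ℝ := fun m n => a m (n + 1) - a m n

/-- A double net is joint completely monotone. -/
def JointCompMono (a : ℕ → ℕ → ℝ) : Prop :=
  ∀ β₁ β₂ m n : ℕ, 0 ≤ (-1 : ℝ) ^ (β₁ + β₂) * d1^[β₁] (d2^[β₂] a) m n

/-- A joint completely monotone double net is minimal. -/
def MinJointCompMono (a : ℕ → ℕ → ℝ) : Prop :=
  JointCompMono a ∧
    (∀ ε : ℝ, 0 < ε → ¬ CompMono (fun k => a k 0 - if k = 0 then ε else 0)) ∧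
    (∀ ε : ℝ, 0 < ε → ¬ CompMono (fun k => a 0 k - if k = 0 then ε else 0))

open Filter Topology Finset

/-- The cone of double nets generated under sums and products by nonnegative constants and
reciprocals of affine functions with nonnegative slopes. -/
inductive NetCone : (ℕ → ℕ → ℝ) → Prop
  | const (c : ℝ) (hc : 0 ≤ c) : NetCone fun _ _ => c
  | inv (α β γ : ℝ) (hα : 0 ≤ α) (hβ : 0 ≤ β) (hγ : 0 < γ) :
      NetCone fun m n => 1 / (α * m + β * n + γ)
  | add {f g : ℕ → ℕ → ℝ} (hf : NetCone f) (hg : NetCone g) : NetCone fun m n => f m n + g m n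
  | mul {f g : ℕ → ℕ → ℝ} (hf : NetCone f) (hg : NetCone g) : NetCone fun m n => f m n * g m n

namespace NetCone

theorem nonneg {f : ℕ → ℕ → ℝ} (hf : NetCone f) (m n : ℕ) : 0 ≤ f m n := by
  induction hf with
  | const c hc => exact hc
  | inv α β γ hα hβ hγ => positivity
  | add _ _ hf hg => exact add_nonneg hf hg
  | mul _ _ hf hg => exact mul_nonneg hf hg

theorem shift {f : ℕ → ℕ → ℝ} (hf : NetCone f) (i j : ℕ) :
    NetCone fun m n => f (m + i) (n + j) := by
  induction hf with
  | const c hc => exact const c hc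
  | inv α β γ hα hβ hγ =>
    have h := inv α β (α * i + β * j + γ) hα hβ (by positivity)
    convert h using 4
    push_cast
    ring
  | add _ _ hf hg => exact add hf hg
  | mul _ _ hf hg => exact mul hf hg

theorem sub_shift {f : ℕ → ℕ → ℝ} (hf : NetCone f) (i j : ℕ) :
    NetCone fun m n => f m n - f (m + i) (n + j) := by
  induction hf with
  | const c hc => simpa using const 0 le_rfl
  | inv α β γ hα hβ hγ =>
    have h := mul (const (α * i + β * j) (by positivity))
      (mul (inv α β γ hα hβ hγ) ((inv α β γ hα hβ hγ).shift i j))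
    convert h using 3 with m n
    have h₁ : α * m + β * n + γ ≠ 0 := by positivity
    have h₂ : α * (m + i : ℕ) + β * (n + j : ℕ) + γ ≠ 0 := by positivity
    push_cast at h₂ ⊢
    field_simp
    ring
  | add _ _ hf hg =>
    convert add hf hg using 3
    ring
  | mul hf₀ hg₀ hf hg =>
    convert add (mul hf hg₀) (mul (hf₀.shift i j) hg) using 3
    ring

theorem iterate_d2 {f : ℕ → ℕ → ℝ} (hf : NetCone f) (k : ℕ) :
    NetCone fun m n => (-1 : ℝ) ^ k * d2^[k] f m n := by
  induction k with
  | zero => simpa using hf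
  | succ k ih =>
    convert ih.sub_shift 0 1 using 3
    rw [Function.iterate_succ_apply', d2]
    ring_nf

theorem iterate_d1 {f : ℕ → ℕ → ℝ} {l : ℕ} (hf : NetCone fun m n => (-1 : ℝ) ^ l * f m n)
    (k : ℕ) : NetCone fun m n => (-1 : ℝ) ^ (k + l) * d1^[k] f m n := by
  induction k with
  | zero => simpa using hf
  | succ k ih =>
    convert ih.sub_shift 1 0 using 3
    rw [Function.iterate_succ_apply', d1]
    ring_nf

theorem jointCompMono {f : ℕ → ℕ → ℝ} (hf : NetCone f) : JointCompMono f :=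
  fun k l m n => ((hf.iterate_d2 l).iterate_d1 k).nonneg m n

theorem pow {f : ℕ → ℕ → ℝ} (hf : NetCone f) (k : ℕ) : NetCone fun m n => f m n ^ k := by
  induction k with
  | zero => simpa using const 1 zero_le_one
  | succ k ih => simpa only [pow_succ] using mul ih hf

theorem sum_range {f : ℕ → ℕ → ℕ → ℝ} (hf : ∀ k, NetCone (f k)) (K : ℕ) :
    NetCone fun m n => ∑ k ∈ range K, f k m n := by
  induction K with
  | zero => simpa using const 0 le_rfl
  | succ K ih => simpa only [sum_range_succ] using add ih (hf K)

end NetCone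

theorem tendsto_iterate_d2 {f : ℕ → ℕ → ℕ → ℝ} {g : ℕ → ℕ → ℝ}
    (h : ∀ m n, Tendsto (fun k => f k m n) atTop (𝓝 (g m n))) (j m n : ℕ) :
    Tendsto (fun k => d2^[j] (f k) m n) atTop (𝓝 (d2^[j] g m n)) := by
  induction j generalizing n with
  | zero => exact h m n
  | succ j ih =>
    simp only [Function.iterate_succ_apply', d2]
    exact (ih (n + 1)).sub (ih n)

theorem tendsto_iterate_d1 {f : ℕ → ℕ → ℕ → ℝ} {g : ℕ → ℕ → ℝ}
    (h : ∀ m n, Tendsto (fun k => f k m n) atTop (𝓝 (g m n))) (j m n : ℕ) :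
    Tendsto (fun k => d1^[j] (f k) m n) atTop (𝓝 (d1^[j] g m n)) := by
  induction j generalizing m with
  | zero => exact h m n
  | succ j ih =>
    simp only [Function.iterate_succ_apply', d1]
    exact (ih (m + 1)).sub (ih m)

theorem JointCompMono.of_tendsto {f : ℕ → ℕ → ℕ → ℝ} {g : ℕ → ℕ → ℝ}
    (hf : ∀ k, JointCompMono (f k))
    (h : ∀ m n, Tendsto (fun k => f k m n) atTop (𝓝 (g m n))) : JointCompMono g :=
  fun i j m n => ge_of_tendsto'
    ((tendsto_iterate_d1 (tendsto_iterate_d2 h j) i m n).const_mul _) fun k => hf k i j m n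

theorem jointCompMono_of_between {a₀ a₁ b₀ b₁ b₂ : ℝ} (ha₀ : 0 < a₀) (ha₁ : 0 < a₁)
    (hb₀ : 0 < b₀) (hb₁ : 0 < b₁) (hb₂ : 0 < b₂) (h₁ : b₁ ≤ a₁) (h₂ : a₁ ≤ b₂) :
    JointCompMono (fun m n =>
      1 / (b₀ * ((m : ℝ) + b₁) * ((m : ℝ) + b₂) + a₀ * ((m : ℝ) + a₁) * n)) := by
  set c := b₁ + b₂ - a₁ with hc
  set d := (a₁ - b₁) * (b₂ - a₁) with hd
  have hc₀ : 0 < c := by linarith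
  have hd₀ : 0 ≤ d := mul_nonneg (by linarith) (by linarith)
  have huv := NetCone.mul (NetCone.inv 1 0 a₁ zero_le_one le_rfl ha₁)
    (NetCone.inv b₀ a₀ (b₀ * c) hb₀.le ha₀.le (by positivity))
  have hq := NetCone.mul (NetCone.const (b₀ * d) (by positivity)) huv
  refine JointCompMono.of_tendsto
    (fun K => (NetCone.mul huv (NetCone.sum_range (fun k => hq.pow k) K)).jointCompMono)
    fun m n => ?_
  have hx : (0 : ℝ) < 1 * m + 0 * n + a₁ := by positivity
  have hy : 0 < b₀ * m + a₀ * n + b₀ * c := by positivity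
  have hz : 0 < b₀ * ((m : ℝ) + b₁) * ((m : ℝ) + b₂) + a₀ * ((m : ℝ) + a₁) * n := by positivity
  have hxy : b₀ * ((m : ℝ) + b₁) * ((m : ℝ) + b₂) + a₀ * ((m : ℝ) + a₁) * n
      = (1 * m + 0 * n + a₁) * (b₀ * m + a₀ * n + b₀ * c) - b₀ * d := by
    rw [hc, hd]
    ring
  rw [hxy] at hz ⊢
  generalize (1 * m + 0 * n + a₁ : ℝ) = x at *
  generalize b₀ * m + a₀ * n + b₀ * c = y at *
  have hr : b₀ * d * (1 / x * (1 / y)) < 1 := by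
    rw [one_div_mul_one_div, mul_one_div, div_lt_one (by positivity)]
    linarith
  convert ((hasSum_geometric_of_lt_one (by positivity) hr).tendsto_sum_nat).const_mul
    (1 / x * (1 / y)) using 2
  have h₃ : 1 - b₀ * d * (1 / x * (1 / y)) = (x * y - b₀ * d) / (x * y) := by
    field_simp
  rw [h₃]
  field_simp

/-- Rising factorial of a real number, as a product starting at `p`. -/
def risingProd (p : ℝ) (K : ℕ) : ℝ := ∏ i ∈ range K, ((i : ℝ) + p)

theorem risingProd_succ (p : ℝ) (K : ℕ) : risingProd p (K + 1) = risingProd p K * (K + p) :=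
  prod_range_succ _ _

theorem risingProd_succ' (p : ℝ) (K : ℕ) : risingProd p (K + 1) = p * risingProd (p + 1) K := by
  simp only [risingProd, prod_range_succ', Nat.cast_zero, zero_add, mul_comm p]
  congr 1
  refine prod_congr rfl fun i _ => ?_
  push_cast
  ring

theorem risingProd_pos {p : ℝ} (hp : 0 < p) (K : ℕ) : 0 < risingProd p K :=
  prod_pos fun i _ => by positivity

theorem tendsto_risingProd_div_atTop {u v : ℝ} (hv : 0 < v) (huv : v < u) :
    Tendsto (fun K => risingProd u K / risingProd v K) atTop atTop := by
  set ε := (u - v) / (v + 1)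
  have hε : 0 < ε := div_pos (by linarith) (by linarith)
  refine tendsto_atTop_mono (f := fun K => ε * ∑ i ∈ range K, 1 / ((i : ℝ) + 1)) (fun K => ?_)
    (Real.tendsto_sum_range_one_div_nat_succ_atTop.const_mul_atTop hε)
  suffices h : 1 + ε * ∑ i ∈ range K, 1 / ((i : ℝ) + 1) ≤ risingProd u K / risingProd v K by
    linarith
  induction K with
  | zero => simp [risingProd]
  | succ K ih =>
    have hS : 0 ≤ ∑ i ∈ range K, 1 / ((i : ℝ) + 1) := sum_nonneg fun i _ => by positivity
    have hone : 1 ≤ risingProd u K / risingProd v K := by nlinarith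
    have hf : 1 + ε * (1 / ((K : ℝ) + 1)) ≤ (K + u) / (K + v) := by
      have h₁ : ((K : ℝ) + u) / (K + v) = 1 + (u - v) / (K + v) := by
        field_simp
        ring
      have h₂ : ε * (1 / ((K : ℝ) + 1)) = (u - v) / ((v + 1) * (K + 1)) := by
        simp only [ε]
        field_simp
      rw [h₁, h₂]
      have : 0 ≤ u - v := by linarith
      gcongr
      nlinarith [(Nat.cast_nonneg K : (0 : ℝ) ≤ K), mul_nonneg (Nat.cast_nonneg K) hv.le]
    rw [sum_range_succ, risingProd_succ, risingProd_succ, mul_div_mul_comm]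
    have hp : 0 < ε * (1 / ((K : ℝ) + 1)) := by positivity
    nlinarith [mul_le_mul_of_nonneg_left hf (zero_le_one.trans hone)]

theorem iterate_dSeq_sub (s t : ℕ → ℝ) (k m : ℕ) :
    dSeq^[k] (fun i => s i - t i) m = dSeq^[k] s m - dSeq^[k] t m := by
  induction k generalizing m with
  | zero => rfl
  | succ k ih =>
    simp only [Function.iterate_succ_apply', dSeq, ih]
    ring

theorem iterate_dSeq_const_mul (c : ℝ) (s : ℕ → ℝ) (k m : ℕ) :
    dSeq^[k] (fun i => c * s i) m = c * dSeq^[k] s m := by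
  induction k generalizing m with
  | zero => rfl
  | succ k ih =>
    simp only [Function.iterate_succ_apply', dSeq, ih]
    ring

theorem iterate_dSeq_one_div {p : ℝ} (hp : 0 < p) (k m : ℕ) :
    (-1 : ℝ) ^ k * dSeq^[k] (fun i : ℕ => 1 / ((i : ℝ) + p)) m
      = k.factorial / risingProd (m + p) (k + 1) := by
  induction k generalizing m with
  | zero => simp [risingProd]
  | succ k ih =>
    have h : ∀ x y : ℝ, (-1 : ℝ) ^ (k + 1) * (x - y) = (-1) ^ k * y - (-1) ^ k * x := by
      intros
      ring
    rw [Function.iterate_succ_apply', dSeq, h, ih, ih, risingProd_succ' _ (k + 1),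
      risingProd_succ' _ k, risingProd_succ]
    have h₁ := (risingProd_pos (p := m + p + 1) (by positivity) k).ne'
    have h₂ : (m + p : ℝ) ≠ 0 := by positivity
    have h₃ : (k + (m + p + 1) : ℝ) ≠ 0 := by positivity
    have h₄ : ((m + 1 : ℕ) : ℝ) + p = m + p + 1 := by
      push_cast
      ring
    rw [h₄, risingProd_succ, Nat.factorial_succ]
    push_cast
    field_simp
    ring

/-- Partial sums of the Newton series at `x` of the sequence `s`. -/
def newtonSum (s : ℕ → ℝ) (x : ℝ) (K : ℕ) : ℝ :=
  ∑ k ∈ range K, risingProd (-x) k / k.factorial * ((-1) ^ k * dSeq^[k] s 0)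

/-- The Newton series of `h` based at the natural numbers converges to `h x` at `x`. -/
def NewtonConv (h : ℝ → ℝ) (x : ℝ) : Prop :=
  Tendsto (newtonSum (fun m => h m) x) atTop (𝓝 (h x))

theorem NewtonConv.sub {f g : ℝ → ℝ} {x : ℝ} (hf : NewtonConv f x) (hg : NewtonConv g x) :
    NewtonConv (fun y => f y - g y) x := by
  refine (Tendsto.sub hf hg).congr fun K => ?_
  simp only [newtonSum, iterate_dSeq_sub, ← sum_sub_distrib]
  exact sum_congr rfl fun k _ => by ring

theorem NewtonConv.const_mul {f : ℝ → ℝ} {x : ℝ} (hf : NewtonConv f x) (c : ℝ) :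
    NewtonConv (fun y => c * f y) x := by
  refine (Tendsto.const_mul c hf).congr fun K => ?_
  simp only [newtonSum, iterate_dSeq_const_mul, mul_sum]
  exact sum_congr rfl fun k _ => by ring

theorem newtonConv_one_div {p x : ℝ} (hp : 0 < p) (hx₀ : 0 < x) (hx₁ : x < 1) :
    NewtonConv (fun y => 1 / (y + p)) x := by
  have key : ∀ K, newtonSum (fun m : ℕ => 1 / ((m : ℝ) + p)) x K
      = 1 / (x + p) * (1 - risingProd (-x) K / risingProd p K) := by
    intro K
    induction K with
    | zero => simp [newtonSum, risingProd]
    | succ K ih =>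
      rw [newtonSum, sum_range_succ, ← newtonSum, ih, iterate_dSeq_one_div hp,
        Nat.cast_zero, zero_add, risingProd_succ p, risingProd_succ (-x)]
      have h₁ := (risingProd_pos hp K).ne'
      have h₂ : (K + p : ℝ) ≠ 0 := by positivity
      have h₃ : x + p ≠ 0 := by positivity
      have h₄ : (K.factorial : ℝ) ≠ 0 := by positivity
      field_simp
      ring
  have hz : Tendsto (fun K => risingProd (-x) K / risingProd p K) atTop (𝓝 0) := by
    rw [← tendsto_add_atTop_iff_nat 1]
    have h := (tendsto_risingProd_div_atTop (u := p + 1) (v := -x + 1) (by linarith)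
      (by linarith)).inv_tendsto_atTop.const_mul (-x / p)
    rw [mul_zero] at h
    refine h.congr fun K => ?_
    rw [risingProd_succ', risingProd_succ', mul_div_mul_comm, Pi.inv_apply, inv_div]
  have h := (hz.const_sub 1).const_mul (1 / (x + p))
  rw [sub_zero, mul_one] at h
  exact h.congr fun K => (key K).symm

/-- A function whose values on the natural numbers are completely monotone and which is
represented by its Newton series is bounded on `(0, 1)` by its value at `0`. -/
theorem NewtonConv.le_of_compMono {h : ℝ → ℝ} {x : ℝ} (hx₀ : 0 < x) (hx₁ : x < 1)
    (hh : NewtonConv h x) (hs : CompMono fun m => h m) : h x ≤ h 0 := by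
  refine le_of_tendsto ((tendsto_add_atTop_iff_nat 1).2 hh) (Eventually.of_forall fun K => ?_)
  rw [newtonSum, sum_range_succ']
  have h₀ : ∑ k ∈ range K, risingProd (-x) (k + 1) / (k + 1).factorial *
      ((-1) ^ (k + 1) * dSeq^[k + 1] (fun m => h m) 0) ≤ 0 := by
    refine sum_nonpos fun k _ => mul_nonpos_of_nonpos_of_nonneg ?_ (hs _ _)
    refine div_nonpos_of_nonpos_of_nonneg ?_ (by positivity)
    rw [risingProd_succ']
    nlinarith [risingProd_pos (p := -x + 1) (by linarith) k]
  simp only [risingProd, range_zero, prod_empty, Nat.factorial_zero, Nat.cast_one, div_one,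
    pow_zero, one_mul, Function.iterate_zero, id, Nat.cast_zero] at h₀ ⊢
  linarith

theorem newtonConv_one_div_quadratic {a₀ a₁ b₀ b₁ b₂ x : ℝ} (ha₀ : 0 < a₀) (ha₁ : 0 < a₁)
    (hb₀ : 0 < b₀) (hb₁ : 0 < b₁) (hb₂ : 0 < b₂) (h₁ : a₁ < b₁) (hx₀ : 0 < x) (hx₁ : x < 1)
    {r : ℝ} (hr : 0 < r) :
    NewtonConv (fun y => 1 / (b₀ * (y + b₁) * (y + b₂) + a₀ * (y + a₁) * r)) x := by
  set S := b₁ + b₂ + a₀ * r / b₀ with hS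
  set P := b₁ * b₂ + a₀ * r / b₀ * a₁ with hP
  have ht : 0 < a₀ * r / b₀ := by positivity
  have hP₀ : 0 < P := by positivity
  have hS₀ : 0 < S := by positivity
  have hD : 0 < S ^ 2 - 4 * P := by
    have : b₁ ^ 2 - S * b₁ + P < 0 := by
      have : b₁ ^ 2 - S * b₁ + P = -(a₀ * r / b₀ * (b₁ - a₁)) := by
        rw [hS, hP]
        ring
      rw [this, neg_lt_zero]
      exact mul_pos ht (by linarith)
    nlinarith [sq_nonneg (2 * b₁ - S)]
  set D := √(S ^ 2 - 4 * P)
  have hD₀ : 0 < D := Real.sqrt_pos.2 hD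
  have hD₂ : D ^ 2 = S ^ 2 - 4 * P := Real.sq_sqrt hD.le
  have hDS : D < S := by nlinarith
  set p := (S - D) / 2 with hp
  set q := (S + D) / 2 with hq
  have hp₀ : 0 < p := by
    rw [hp]
    linarith
  have hq₀ : 0 < q := by positivity
  have hconv := ((newtonConv_one_div hp₀ hx₀ hx₁).sub (newtonConv_one_div hq₀ hx₀ hx₁)).const_mul
    (1 / (b₀ * D))
  have heq : ∀ y : ℝ, 0 ≤ y → 1 / (b₀ * D) * (1 / (y + p) - 1 / (y + q))
      = 1 / (b₀ * (y + b₁) * (y + b₂) + a₀ * (y + a₁) * r) := by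
    intro y hy
    have hfac : b₀ * (y + b₁) * (y + b₂) + a₀ * (y + a₁) * r = b₀ * ((y + p) * (y + q)) := by
      have : (y + p) * (y + q) = y ^ 2 + S * y + P := by
        rw [hp, hq]
        linear_combination -hD₂ / 4
      rw [this, hS, hP]
      field_simp
      ring
    rw [hfac]
    have hpq : q - p = D := by
      rw [hp, hq]
      ring
    have : y + p ≠ 0 := by positivity
    have : y + q ≠ 0 := by positivity
    rw [div_sub_div _ _ ‹y + p ≠ 0› ‹y + q ≠ 0›, show 1 * (y + q) - (y + p) * 1 = D by linarith]
    field_simp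
  simp only [NewtonConv, heq x hx₀.le, heq _ (Nat.cast_nonneg _)] at hconv
  exact hconv

theorem iterate_d2_eq_iterate_dSeq (a : ℕ → ℕ → ℝ) (k m : ℕ) : d2^[k] a m = dSeq^[k] (a m) := by
  induction k with
  | zero => rfl
  | succ k ih =>
    rw [Function.iterate_succ_apply', Function.iterate_succ_apply', ← ih]
    rfl

theorem iterate_d1_eq_iterate_dSeq (a : ℕ → ℕ → ℝ) (k m n : ℕ) :
    d1^[k] a m n = dSeq^[k] (fun i => a i n) m := by
  induction k generalizing m with
  | zero => rfl
  | succ k ih => simp only [Function.iterate_succ_apply', d1, dSeq, ih]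

theorem JointCompMono.compMono {a : ℕ → ℕ → ℝ} (ha : JointCompMono a) (k n : ℕ) :
    CompMono fun m => (-1) ^ k * dSeq^[k] (a m) n := by
  intro j m
  have h := ha j k m n
  rw [iterate_d1_eq_iterate_dSeq] at h
  simp only [iterate_d2_eq_iterate_dSeq] at h
  rw [iterate_dSeq_const_mul, ← mul_assoc, ← pow_add]
  exact h

theorem newtonConv_iterate_dSeq {F : ℝ → ℕ → ℝ} {x : ℝ}
    (hF : ∀ n, 0 < n → NewtonConv (fun y => F y n) x) (k n : ℕ) (hn : 0 < n) :
    NewtonConv (fun y => dSeq^[k] (F y) n) x := by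
  induction k generalizing n with
  | zero => exact hF n hn
  | succ k ih =>
    simp only [Function.iterate_succ_apply', dSeq]
    exact (ih (n + 1) n.succ_pos).sub (ih n hn)

theorem iterate_dSeq_one_div_affine {a b : ℝ} (ha : 0 < a) (hb : 0 < b) (k n : ℕ) :
    (-1 : ℝ) ^ k * dSeq^[k] (fun i : ℕ => 1 / (b + a * i)) n
      = 1 / a * (k.factorial / risingProd (n + b / a) (k + 1)) := by
  have h : (fun i : ℕ => 1 / (b + a * i)) = fun i : ℕ => 1 / a * (1 / ((i : ℝ) + b / a)) := by
    funext i
    field_simp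
    ring
  rw [h, iterate_dSeq_const_mul, mul_left_comm, iterate_dSeq_one_div (by positivity)]

theorem one_div_le_of_jointCompMono {a₀ a₁ b₀ b₁ b₂ : ℝ} (ha₀ : 0 < a₀) (ha₁ : 0 < a₁)
    (hb₀ : 0 < b₀) (hb₁ : 0 < b₁) (hb₂ : 0 < b₂)
    (H : JointCompMono (fun m n =>
      1 / (b₀ * ((m : ℝ) + b₁) * ((m : ℝ) + b₂) + a₀ * ((m : ℝ) + a₁) * n))) :
    1 / a₁ ≤ 1 / b₁ + 1 / b₂ := by
  by_contra! hlt
  have h₁ : a₁ < b₁ := by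
    have : 0 < 1 / b₂ := by positivity
    exact (one_div_lt_one_div hb₁ ha₁).1 (by linarith)
  have hgap : a₁ * (b₁ + b₂) < b₁ * b₂ := by
    rw [div_add_div _ _ hb₁.ne' hb₂.ne', div_lt_div_iff₀ (by positivity) ha₁] at hlt
    linarith
  obtain ⟨x, hx₀, hx₁, hx⟩ : ∃ x : ℝ, 0 < x ∧ x < 1 ∧ a₁ * (x + b₁ + b₂) < b₁ * b₂ := by
    set δ := (b₁ * b₂ - a₁ * (b₁ + b₂)) / (2 * a₁) with hδ
    have hδ₀ : 0 < δ := div_pos (by linarith) (by linarith)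
    have hδ₁ : 2 * (a₁ * δ) = b₁ * b₂ - a₁ * (b₁ + b₂) := by
      rw [hδ]
      field_simp
    refine ⟨min δ (1 / 2), by positivity, (min_le_right _ _).trans_lt (by norm_num), ?_⟩
    nlinarith [mul_le_mul_of_nonneg_left (min_le_left δ (1 / 2)) ha₁.le, mul_pos ha₁ hδ₀]
  set b : ℝ → ℝ := fun y => b₀ * (y + b₁) * (y + b₂) with hb
  set a : ℝ → ℝ := fun y => a₀ * (y + a₁) with ha
  have hbp : ∀ y, 0 ≤ y → 0 < b y := fun y hy => by positivity
  have hap : ∀ y, 0 ≤ y → 0 < a y := fun y hy => by positivity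
  have hB : b x / a x < b 0 / a 0 := by
    rw [div_lt_div_iff₀ (hap x hx₀.le) (hap 0 le_rfl)]
    have : b 0 * a x - b x * a 0 = a₀ * b₀ * x * (b₁ * b₂ - a₁ * (x + b₁ + b₂)) := by
      simp only [hb, ha]
      ring
    have : 0 < a₀ * b₀ * x * (b₁ * b₂ - a₁ * (x + b₁ + b₂)) :=
      mul_pos (by positivity) (by linarith)
    linarith
  have hle : ∀ k : ℕ, risingProd (1 + b 0 / a 0) (k + 1) / risingProd (1 + b x / a x) (k + 1)
      ≤ a x / a 0 := by
    intro k
    have hconv := (newtonConv_iterate_dSeq (F := fun y n => 1 / (b y + a y * n)) (x := x)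
      (fun n hn => newtonConv_one_div_quadratic ha₀ ha₁ hb₀ hb₁ hb₂ h₁ hx₀ hx₁
        (Nat.cast_pos.2 hn)) k 1 one_pos).const_mul ((-1) ^ k)
    have h := hconv.le_of_compMono hx₀ hx₁ (H.compMono k 1)
    rw [iterate_dSeq_one_div_affine (hap x hx₀.le) (hbp x hx₀.le),
      iterate_dSeq_one_div_affine (hap 0 le_rfl) (hbp 0 le_rfl), Nat.cast_one] at h
    have hx' := hap x hx₀.le
    have h0' := hap 0 le_rfl
    have hR := risingProd_pos (p := 1 + b x / a x)
      (by have := div_pos (hbp x hx₀.le) hx'; linarith) (k + 1)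
    have hR₀ := risingProd_pos (p := 1 + b 0 / a 0)
      (by have := div_pos (hbp 0 le_rfl) h0'; linarith) (k + 1)
    have hk : (0 : ℝ) < k.factorial := by positivity
    rw [div_mul_div_comm, div_mul_div_comm, one_mul,
      div_le_div_iff_of_pos_left hk (by positivity) (by positivity)] at h
    rw [div_le_div_iff₀ hR h0']
    linarith
  have hlim := (tendsto_add_atTop_iff_nat 1).2 (tendsto_risingProd_div_atTop
    (u := 1 + b 0 / a 0) (v := 1 + b x / a x)
    (by have := div_pos (hbp x hx₀.le) (hap x hx₀.le); linarith) (by linarith))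
  obtain ⟨k, hk⟩ := (hlim.eventually_gt_atTop (a x / a 0)).exists
  exact (hle k).not_gt hk

theorem statement16 (a₀ a₁ b₀ b₁ b₂ : ℝ)
    (ha₀ : 0 < a₀) (ha₁ : 0 < a₁) (hb₀ : 0 < b₀) (hb₁ : 0 < b₁) (hb₂ : 0 < b₂) :
    (b₁ ≤ a₁ → a₁ ≤ b₂ →
      JointCompMono (fun m n =>
        1 / (b₀ * ((m : ℝ) + b₁) * ((m : ℝ) + b₂) + a₀ * ((m : ℝ) + a₁) * n))) ∧
    (JointCompMono (fun m n =>
        1 / (b₀ * ((m : ℝ) + b₁) * ((m : ℝ) + b₂) + a₀ * ((m : ℝ) + a₁) * n)) →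
      1 / a₁ ≤ 1 / b₁ + 1 / b₂) := by
  exact ⟨jointCompMono_of_between ha₀ ha₁ hb₀ hb₁ hb₂,
    one_div_le_of_jointCompMono ha₀ ha₁ hb₀ hb₁ hb₂⟩
end
end

section
/- Let H be a complex Hilbert space, let n be a positive integer, and let T = (T_1, …, T_n) be a commuting n-tuple of bounded linear operators on H. Then T is a toral 2-isometry if and only if for every α = (α_1, …, α_n) ∈ ℤ₊ⁿ, T^{*α}T^{α} = I + ∑_{j=1}^n α_j·(T_j^* T_j − I). -/
open ContinuousLinearMap

noncomputable section

variable {H : Type*} [NormedAddCommGroup H] [InnerProductSpace ℂ H] [CompleteSpace H]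

/-- `T^α = ∏ⱼ Tⱼ^{αⱼ}` for a (commuting) tuple of operators. -/
def opPow {n : ℕ} (T : Fin n → (H →L[ℂ] H)) (α : Fin n → ℕ) : H →L[ℂ] H :=
  (List.ofFn (fun j => (T j) ^ (α j))).prod

/-- The operator net `𝔪(α) = T^{*α} T^{α}`. -/
def opNet {n : ℕ} (T : Fin n → (H →L[ℂ] H)) (α : Fin n → ℕ) : H →L[ℂ] H :=
  adjoint (opPow T α) * opPow T α

/-- `T` is a toral `m`-isometry. -/
def ToralIsometry {n : ℕ} (T : Fin n → (H →L[ℂ] H)) (m : ℕ) : Prop :=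
  ∀ β : Fin n → ℕ, (∑ j, β j) = m →
    ∑ α ∈ Finset.Iic β,
      (((-1 : ℂ) ^ (∑ j, α j)) * ∏ j, ((β j).choose (α j) : ℂ)) • opNet T α = 0

theorem opPow_zero {n : ℕ} (T : Fin n → (H →L[ℂ] H)) : opPow T 0 = 1 := by
  simp [opPow]

theorem opPow_succ {n : ℕ} (T : Fin (n + 1) → (H →L[ℂ] H)) (α : Fin (n + 1) → ℕ) :
    opPow T α = T 0 ^ α 0 * opPow (fun j => T j.succ) (fun j => α j.succ) := by
  simp [opPow, List.ofFn_succ]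

theorem opPow_single {n : ℕ} (T : Fin n → (H →L[ℂ] H)) (i : Fin n) :
    opPow T (Pi.single i 1) = T i := by
  induction n with
  | zero => exact i.elim0
  | succ n ih =>
    rw [opPow_succ]
    cases i using Fin.cases with
    | zero =>
      have h : (fun j : Fin n => (Pi.single 0 1 : Fin (n + 1) → ℕ) j.succ) = 0 := by
        ext j; simp
      rw [h, opPow_zero]; simp
    | succ i =>
      have h : (fun j : Fin n => (Pi.single i.succ 1 : Fin (n + 1) → ℕ) j.succ)
          = Pi.single i 1 := by
        ext j; simp [Pi.single_apply]
      rw [h, ih]; simp [(Fin.succ_ne_zero i).symm]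

theorem commute_opPow {n : ℕ} {T : Fin n → (H →L[ℂ] H)} {S : H →L[ℂ] H}
    (h : ∀ j, Commute S (T j)) (α : Fin n → ℕ) : Commute S (opPow T α) := by
  refine Commute.list_prod_right _ _ fun x hx => ?_
  obtain ⟨j, rfl⟩ := (List.mem_ofFn' _ _).1 hx
  exact (h j).pow_right _

theorem opPow_add {n : ℕ} {T : Fin n → (H →L[ℂ] H)} (h : ∀ i j, T i * T j = T j * T i)
    (α β : Fin n → ℕ) : opPow T (α + β) = opPow T α * opPow T β := by
  induction n with
  | zero => simp [opPow]
  | succ n ih =>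
    have hc : Commute (T 0 ^ β 0) (opPow (fun j => T j.succ) (fun j => α j.succ)) :=
      commute_opPow (fun j => Commute.pow_left (h 0 j.succ) _) _
    have ih' := ih (fun i j => h i.succ j.succ) (fun j => α j.succ) (fun j => β j.succ)
    rw [opPow_succ, opPow_succ T α, opPow_succ T β, Pi.add_apply, pow_add, mul_assoc, mul_assoc,
      ← hc.left_comm, ← ih', ← mul_assoc, ← mul_assoc]
    rfl

theorem opNet_add {n : ℕ} {T : Fin n → (H →L[ℂ] H)} (h : ∀ i j, T i * T j = T j * T i)
    (α β : Fin n → ℕ) :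
    opNet T (α + β) = adjoint (opPow T β) * opNet T α * opPow T β := by
  simp only [opNet, opPow_add h, ← star_eq_adjoint, star_mul, mul_assoc]

theorem opNet_zero {n : ℕ} (T : Fin n → (H →L[ℂ] H)) : opNet T 0 = 1 := by
  simp [opNet, opPow_zero, ← star_eq_adjoint]

theorem opNet_single {n : ℕ} (T : Fin n → (H →L[ℂ] H)) (i : Fin n) :
    opNet T (Pi.single i 1) = adjoint (T i) * T i := by
  rw [opNet, opPow_single]

theorem multiIndex_induction {ι : Type*} [Fintype ι] [DecidableEq ι] {p : (ι → ℕ) → Prop}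
    (zero : p 0) (add_single : ∀ γ i, p γ → p (γ + Pi.single i 1)) (γ : ι → ℕ) : p γ := by
  induction hk : ∑ j, γ j generalizing γ with
  | zero =>
    have : γ = 0 := by ext j; simpa using (Finset.sum_eq_zero_iff.1 hk) j (Finset.mem_univ j)
    rwa [this]
  | succ k ih =>
    obtain ⟨i, -, hi⟩ := Finset.exists_ne_zero_of_sum_ne_zero (hk.trans_ne k.succ_ne_zero)
    have hγ : γ - Pi.single i 1 + Pi.single i 1 = γ :=
      tsub_add_cancel_of_le fun j => by
        rw [Pi.single_apply]; split_ifs with h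
        · exact h ▸ Nat.one_le_iff_ne_zero.2 hi
        · exact Nat.zero_le _
    rw [← hγ]
    refine add_single _ _ (ih _ ?_)
    have := congrArg (fun δ : ι → ℕ => ∑ j, δ j) hγ
    simp only [Pi.add_apply, Finset.sum_add_distrib, Finset.sum_pi_single', hk,
      Finset.mem_univ, if_true] at this
    omega

theorem exists_eq_single_add_single {ι : Type*} [Fintype ι] [DecidableEq ι] {β : ι → ℕ}
    (h : ∑ j, β j = 2) : ∃ i j, β = Pi.single i 1 + Pi.single j 1 := by
  have peel : ∀ (k : ℕ) (γ : ι → ℕ), ∑ j, γ j = k + 1 →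
      ∃ (i : ι) (δ : ι → ℕ), γ = δ + Pi.single i 1 ∧ ∑ j, δ j = k := by
    intro k γ
    refine multiIndex_induction (p := fun γ => ∑ j, γ j = k + 1 →
      ∃ (i : ι) (δ : ι → ℕ), γ = δ + Pi.single i 1 ∧ ∑ j, δ j = k) (by simp) ?_ γ
    intro δ i _ hδ
    refine ⟨i, δ, rfl, ?_⟩
    simpa [Finset.sum_add_distrib] using hδ
  obtain ⟨i, δ, rfl, hδ⟩ := peel 1 β h
  obtain ⟨j, ε, rfl, hε⟩ := peel 0 δ hδ
  have : ε = 0 := by ext j; simpa using (Finset.sum_eq_zero_iff.1 hε) j (Finset.mem_univ j)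
  exact ⟨j, i, by simp [this]⟩

theorem sum_Iic_single_add_single {ι E : Type*} [Fintype ι] [DecidableEq ι] [AddCommGroup E]
    [Module ℂ E] (f : (ι → ℕ) → E) (i j : ι) :
    ∑ α ∈ Finset.Iic (Pi.single i 1 + Pi.single j 1 : ι → ℕ),
      (((-1 : ℂ) ^ (∑ k, α k)) *
        ∏ k, (((Pi.single i 1 + Pi.single j 1 : ι → ℕ) k).choose (α k) : ℂ)) • f α =
      f (Pi.single i 1 + Pi.single j 1) - f (Pi.single i 1) - f (Pi.single j 1) + f 0 := by
  rcases eq_or_ne i j with rfl | hij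
  · have hs : Finset.Iic (Pi.single i 1 + Pi.single i 1 : ι → ℕ) =
        {0, Pi.single i 1, Pi.single i 1 + Pi.single i 1} := by
      ext α
      simp only [Finset.mem_Iic, Finset.mem_insert, Finset.mem_singleton, Pi.le_def,
        funext_iff, Pi.add_apply, Pi.single_apply, Pi.zero_apply]
      constructor
      · intro h
        have hi := h i
        simp only [if_true] at hi
        have hc : α i = 0 ∨ α i = 1 ∨ α i = 2 := by omega
        refine hc.imp ?_ (Or.imp ?_ ?_) <;>
        · intro h1 k
          have := h k
          grind
      · grind
    have h1 : (0 : ι → ℕ) ≠ Pi.single i 1 := fun h => by simpa using congrFun h i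
    have h2 : (0 : ι → ℕ) ≠ Pi.single i 1 + Pi.single i 1 := fun h => by
      simpa using congrFun h i
    have h3 : (Pi.single i 1 : ι → ℕ) ≠ Pi.single i 1 + Pi.single i 1 := fun h => by
      simpa using congrFun h i
    have hp : ∏ k, (((Pi.single i 1 + Pi.single i 1 : ι → ℕ) k).choose
        ((Pi.single i 1 : ι → ℕ) k) : ℂ) = 2 := by
      rw [Finset.prod_eq_single i]
      · simp
      · intro k _ hk; simp [hk]
      · simp
    rw [hs, Finset.sum_insert (by simp [h1, h2]), Finset.sum_insert (by simp [h3]),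
      Finset.sum_singleton, hp]
    simp only [Pi.add_apply, Pi.zero_apply, Finset.sum_add_distrib, Finset.sum_pi_single',
      Nat.choose_self, Nat.choose_zero_right]
    simp
    module
  · have hs : Finset.Iic (Pi.single i 1 + Pi.single j 1 : ι → ℕ) =
        {0, Pi.single i 1, Pi.single j 1, Pi.single i 1 + Pi.single j 1} := by
      ext α
      simp only [Finset.mem_Iic, Finset.mem_insert, Finset.mem_singleton, Pi.le_def,
        funext_iff, Pi.add_apply, Pi.single_apply, Pi.zero_apply]
      constructor
      · intro h
        have hi := h i
        have hj := h j
        simp only [if_true, hij, hij.symm, if_false] at hi hj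
        have hc : (α i = 0 ∧ α j = 0) ∨ (α i = 1 ∧ α j = 0) ∨ (α i = 0 ∧ α j = 1) ∨
          (α i = 1 ∧ α j = 1) := by omega
        refine hc.imp ?_ (Or.imp ?_ (Or.imp ?_ ?_)) <;>
        · intro h1 k
          have := h k
          grind
      · grind
    have hp : ∀ α ∈ Finset.Iic (Pi.single i 1 + Pi.single j 1 : ι → ℕ),
        ∏ k, (((Pi.single i 1 + Pi.single j 1 : ι → ℕ) k).choose (α k) : ℂ) = 1 := by
      intro α hα
      refine Finset.prod_eq_one fun k _ => ?_
      have hk := Finset.mem_Iic.1 hα k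
      have hle : (Pi.single i 1 + Pi.single j 1 : ι → ℕ) k ≤ 1 := by
        simp only [Pi.add_apply, Pi.single_apply]; grind
      generalize (Pi.single i 1 + Pi.single j 1 : ι → ℕ) k = b at hk hle
      generalize α k = a at hk
      interval_cases b <;> interval_cases a <;> simp
    have h1 : ∀ k, (0 : ι → ℕ) ≠ Pi.single k 1 := fun k h => by simpa using congrFun h k
    have h2 : (0 : ι → ℕ) ≠ Pi.single i 1 + Pi.single j 1 := fun h => by
      simpa [hij] using congrFun h i
    have h3 : (Pi.single i 1 : ι → ℕ) ≠ Pi.single j 1 := fun h => by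
      simpa [hij] using congrFun h i
    have h4 : (Pi.single i 1 : ι → ℕ) ≠ Pi.single i 1 + Pi.single j 1 := fun h => by
      simpa using congrFun h j
    have h5 : (Pi.single j 1 : ι → ℕ) ≠ Pi.single i 1 + Pi.single j 1 := fun h => by
      simpa using congrFun h i
    rw [Finset.sum_congr rfl fun α hα => by rw [hp α hα], hs,
      Finset.sum_insert (by simp [h1, h2]), Finset.sum_insert (by simp [h3, h4]),
      Finset.sum_insert (by simp [h5]), Finset.sum_singleton]
    simp only [Pi.add_apply, Pi.zero_apply, Finset.sum_add_distrib]
    simp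
    module

theorem toralIsometry_two_iff {n : ℕ} (T : Fin n → (H →L[ℂ] H)) :
    ToralIsometry T 2 ↔ ∀ i j, opNet T (Pi.single i 1 + Pi.single j 1) -
      opNet T (Pi.single i 1) - opNet T (Pi.single j 1) + opNet T 0 = 0 := by
  constructor
  · intro h i j
    rw [← sum_Iic_single_add_single]
    exact h _ (by simp [Finset.sum_add_distrib])
  · intro h β hβ
    obtain ⟨i, j, rfl⟩ := exists_eq_single_add_single hβ
    rw [sum_Iic_single_add_single]
    exact h i j

theorem ToralIsometry.opNet_add_single {n : ℕ} {T : Fin n → (H →L[ℂ] H)}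
    (hT : ToralIsometry T 2) (hcomm : ∀ i j, T i * T j = T j * T i) (γ : Fin n → ℕ)
    (i : Fin n) : opNet T (γ + Pi.single i 1) = opNet T γ + (adjoint (T i) * T i - 1) := by
  induction γ using multiIndex_induction with
  | zero => rw [zero_add, opNet_single, opNet_zero]; abel
  | add_single γ j ih =>
    have h := congrArg (fun S => adjoint (opPow T γ) * S * opPow T γ)
      ((toralIsometry_two_iff T).1 hT j i)
    simp only [mul_add, mul_sub, add_mul, sub_mul, ← opNet_add hcomm, mul_zero, zero_mul,
      zero_add] at h
    rw [add_comm _ γ, add_comm _ γ, add_comm _ γ, ← add_assoc, ih] at h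
    rw [← sub_eq_zero, ← h]
    abel

theorem statement18 (n : ℕ) (hn : 0 < n)
    (T : Fin n → (H →L[ℂ] H)) (hcomm : ∀ i j, T i * T j = T j * T i) :
    ToralIsometry T 2 ↔
      ∀ α : Fin n → ℕ, opNet T α =
        1 + ∑ j, ((α j : ℂ)) • (adjoint (T j) * T j - 1) := by
  constructor
  · intro hT α
    induction α using multiIndex_induction with
    | zero => simp [opNet_zero]
    | add_single γ i ih =>
      have hs : ∑ j, ((Pi.single i 1 : Fin n → ℕ) j : ℂ) • (adjoint (T j) * T j - 1) =
          adjoint (T i) * T i - 1 := by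
        simp [Pi.single_apply]
      rw [hT.opNet_add_single hcomm, ih]
      simp only [Pi.add_apply, Nat.cast_add, add_smul, Finset.sum_add_distrib, hs, add_assoc]
  · intro h
    rw [toralIsometry_two_iff]
    intro i j
    simp only [h, Pi.add_apply, Nat.cast_add, add_smul, Finset.sum_add_distrib, Pi.zero_apply,
      Nat.cast_zero, zero_smul, Finset.sum_const_zero]
    abel
end
end
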